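/- For every x ∈ ℝ^d, z ∈ ℂ^d, and 1 ≤ l ≤ d, the holomorphic partial derivative of G with respect to z_l satisfies ∂G/∂z_l (x, z) = 2 ⟨ U_A e_l, |A|⁻¹ x / √ℏ − conj(U_A) z ⟩ · G(x, z), where e_l is the l-th standard basis vector and conj(U_A) is the entrywise complex conjugate of U_A. -/

import Mathlib

open Matrix Complex
open scoped ComplexOrder

noncomputable section

/-- The pairing `⟨a, b⟩ = ∑ j, conj (a j) * b j` on `ℂ^d`. -/
def cinner {d : ℕ} (a b : Fin d → ℂ) : ℂ := ∑ j, (starRingEnd ℂ) (a j) * b j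

/-- The embedding of `ℝ^d` into `ℂ^d`. -/
def cvec {d : ℕ} (x : Fin d → ℝ) : Fin d → ℂ := fun j => (x j : ℂ)

/-- The `l`-th standard basis vector of `ℂ^d`. -/
def stdC {d : ℕ} (l : Fin d) : Fin d → ℂ := Pi.single l 1

/-- The gradient of `ψ : ℝ^d → ℂ`, viewed as the vector of partial derivatives. -/
def grad {d : ℕ} (ψ : (Fin d → ℝ) → ℂ) (x : Fin d → ℝ) : Fin d → ℂ :=
  fun j => fderiv ℝ ψ x (Pi.single j 1)

/-- The raising operator `R_l` built from `(A, B)` at semiclassical parameter `h`. -/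
def raiseOp {d : ℕ} (A B : Matrix (Fin d) (Fin d) ℂ) (h : ℝ) (l : Fin d)
    (ψ : (Fin d → ℝ) → ℂ) : (Fin d → ℝ) → ℂ := fun x =>
  ((Real.sqrt (2 * h) : ℝ) : ℂ)⁻¹ *
    (cinner (B.mulVec (stdC l)) (cvec x) * ψ x
      - (h : ℂ) * cinner (A.mulVec (stdC l)) (grad ψ x))

/-- The ground state Gaussian `φ₀`, where `sqrtA` is a fixed branch of `√(det A)`. -/
def phi0 {d : ℕ} (A B : Matrix (Fin d) (Fin d) ℂ) (h : ℝ) (sqrtA : ℂ)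
    (x : Fin d → ℝ) : ℂ :=
  ((Real.pi ^ (-(d : ℝ) / 4) * h ^ (-(d : ℝ) / 4) : ℝ) : ℂ) * sqrtA⁻¹ *
    Complex.exp (-(cinner (cvec x) ((B * A⁻¹).mulVec (cvec x)) / ((2 * h : ℝ) : ℂ)))

/-- `R_1^{k_1} ∘ ⋯ ∘ R_d^{k_d}` for a family of operators `R` and a multi-index `k`. -/
def opPow {d : ℕ} {α : Type*} (R : Fin d → (α → α)) (k : Fin d → ℕ) : α → α :=
  (List.finRange d).foldr (fun l f => (R l)^[k l] ∘ f) id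

/-- The polynomials `P_k(A, h, x)`:
`P_k = 2^{|k|/2} (R_1^{k_1} ∘ ⋯ ∘ R_d^{k_d} φ₀)(x) / φ₀(x)`. -/
def Ppoly {d : ℕ} (A B : Matrix (Fin d) (Fin d) ℂ) (h : ℝ) (sqrtA : ℂ)
    (k : Fin d → ℕ) (x : Fin d → ℝ) : ℂ :=
  (((2 : ℝ) ^ (((∑ l, k l : ℕ) : ℝ) / 2) : ℝ) : ℂ) *
    opPow (raiseOp A B h) k (phi0 A B h sqrtA) x / phi0 A B h sqrtA x

/-- The coordinate partial derivative `∂_j` acting on functions on `ℝ^d`. -/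
def pdC {d : ℕ} (j : Fin d) (f : (Fin d → ℝ) → ℂ) : (Fin d → ℝ) → ℂ :=
  fun x => fderiv ℝ f x (Pi.single j 1)

/-- The generating function
`G(x,z) = exp(−⟨conj z, A⁻¹ conj(A) z⟩ + (2/√h) ⟨conj z, A⁻¹ x⟩)`. -/
def Gfun {d : ℕ} (A : Matrix (Fin d) (Fin d) ℂ) (h : ℝ) (x : Fin d → ℝ)
    (z : Fin d → ℂ) : ℂ :=
  Complex.exp
    (-(cinner (fun j => (starRingEnd ℂ) (z j)) ((A⁻¹ * A.map (starRingEnd ℂ)).mulVec z))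
      + (2 / ((Real.sqrt h : ℝ) : ℂ)) *
          cinner (fun j => (starRingEnd ℂ) (z j)) (A⁻¹.mulVec (cvec x)))

/-- The holomorphic partial derivative `∂/∂z_l` of a function on `ℂ^d`. -/
def dz {d : ℕ} (l : Fin d) (f : (Fin d → ℂ) → ℂ) : (Fin d → ℂ) → ℂ :=
  fun z => deriv (fun t => f (Function.update z l t)) (z l)


theorem map_starRingEnd_eq {m n : Type*} (A : Matrix m n ℂ) :
    A.map (starRingEnd ℂ) = Aᴴᵀ := rfl

section

open scoped MatrixOrder Matrix.Norms.L2Operator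

/-- Positive semidefinite square roots of complex matrices are unique. -/
theorem Matrix.PosSemidef.eq_of_mul_self_eq {n : Type*} [Fintype n] [DecidableEq n]
    {S T : Matrix n n ℂ} (hS : S.PosSemidef) (hT : T.PosSemidef) (h : S * S = T * T) :
    S = T := by
  rw [← CFC.sqrt_unique h hS.nonneg, CFC.sqrt_mul_self T hT.nonneg]

end

section

variable {n : Type*} [Fintype n] [DecidableEq n] {A B S : Matrix n n ℂ}

/-- If `(A, B)` satisfies the symplectic relations, then `A * Aᴴ` is a symmetric matrix. -/
theorem isSymm_mul_conjTranspose (hA : IsUnit A.det)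
    (h₁ : Aᴴ * B + Bᴴ * A = (2 : ℂ) • (1 : Matrix n n ℂ))
    (h₂ : Aᵀ * B - Bᵀ * A = 0) : (A * Aᴴ).IsSymm := by
  have hAt : IsUnit Aᵀ.det := A.isUnit_det_transpose hA
  have hAh : IsUnit Aᴴ.det := by rw [det_conjTranspose]; exact hA.star
  have hsymm : (B * A⁻¹)ᵀ = B * A⁻¹ := by
    rw [transpose_mul, transpose_nonsing_inv]
    calc Aᵀ⁻¹ * Bᵀ = Aᵀ⁻¹ * (Bᵀ * A) * A⁻¹ := by
          rw [← Matrix.mul_assoc, mul_nonsing_inv_cancel_right _ _ hA]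
      _ = B * A⁻¹ := by
          rw [← sub_eq_zero.mp h₂, nonsing_inv_mul_cancel_left _ _ hAt]
  have hsum : B * A⁻¹ + (B * A⁻¹)ᴴ = (2 : ℂ) • (A * Aᴴ)⁻¹ := by
    calc B * A⁻¹ + (B * A⁻¹)ᴴ = Aᴴ⁻¹ * (Aᴴ * B + Bᴴ * A) * A⁻¹ := by
          rw [Matrix.mul_add, Matrix.add_mul, nonsing_inv_mul_cancel_left _ _ hAh,
            ← Matrix.mul_assoc, mul_nonsing_inv_cancel_right _ _ hA, conjTranspose_mul,
            conjTranspose_nonsing_inv]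
      _ = (2 : ℂ) • (A * Aᴴ)⁻¹ := by
          rw [h₁, Matrix.mul_inv_rev]; simp
  have hinv : (A * Aᴴ)⁻¹ᵀ = (A * Aᴴ)⁻¹ := by
    have ht := congrArg transpose hsum
    have hc : (B * A⁻¹)ᴴᵀ = (B * A⁻¹)ᴴ := congrArg conjTranspose hsymm
    rw [transpose_add, hsymm, hc, hsum, transpose_smul] at ht
    exact (smul_right_injective _ (two_ne_zero (α := ℂ)) ht).symm
  have hu : IsUnit (A * Aᴴ).det := by rw [det_mul]; exact hA.mul hAh
  rw [transpose_nonsing_inv] at hinv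
  exact inv_inj hinv ((A * Aᴴ).isUnit_det_transpose hu)

/-- If `A * Aᴴ` is symmetric, then so is `A⁻¹ * conj A`. -/
theorem isSymm_inv_mul_conj (hA : IsUnit A.det) (h : (A * Aᴴ).IsSymm) :
    (A⁻¹ * Aᴴᵀ).IsSymm := by
  have hAt : IsUnit Aᵀ.det := A.isUnit_det_transpose hA
  have h' : Aᴴᵀ * Aᵀ = A * Aᴴ := by rw [← transpose_mul]; exact h
  change (A⁻¹ * Aᴴᵀ)ᵀ = A⁻¹ * Aᴴᵀ
  rw [transpose_mul, transpose_transpose, transpose_nonsing_inv]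
  calc Aᴴ * Aᵀ⁻¹ = A⁻¹ * (A * Aᴴ) * Aᵀ⁻¹ := by rw [nonsing_inv_mul_cancel_left _ _ hA]
    _ = A⁻¹ * Aᴴᵀ := by
      rw [← h', Matrix.mul_assoc, mul_nonsing_inv_cancel_right _ _ hAt]

theorem conjTranspose_polar_mul_inv (hA : IsUnit A.det) (hS : S.IsHermitian)
    (hSS : S * S = A * Aᴴ) : (S⁻¹ * A)ᴴ * S⁻¹ = A⁻¹ := by
  have hAh : IsUnit Aᴴ.det := by rw [det_conjTranspose]; exact hA.star
  rw [conjTranspose_mul, conjTranspose_nonsing_inv, hS.eq, Matrix.mul_assoc,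
    ← Matrix.mul_inv_rev, hSS, Matrix.mul_inv_rev, mul_nonsing_inv_cancel_left _ _ hAh]

theorem conjTranspose_polar_mul_conj_polar (hA : IsUnit A.det) (hS : S.PosDef)
    (hSS : S * S = A * Aᴴ) (h : (A * Aᴴ).IsSymm) :
    (S⁻¹ * A)ᴴ * (S⁻¹ * A)ᴴᵀ = A⁻¹ * Aᴴᵀ := by
  have hSt : Sᵀ = S := by
    refine hS.posSemidef.transpose.eq_of_mul_self_eq hS.posSemidef ?_
    rw [← transpose_mul, hSS, h.eq]
  have hconj : (S⁻¹ * A)ᴴᵀ = S⁻¹ * Aᴴᵀ := by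
    rw [conjTranspose_mul, conjTranspose_nonsing_inv, hS.isHermitian.eq, transpose_mul,
      transpose_nonsing_inv, hSt]
  rw [hconj, ← Matrix.mul_assoc, conjTranspose_polar_mul_inv hA hS.isHermitian hSS]

theorem hasDerivAt_dotProduct_mulVec_update {M : Matrix n n ℂ} (hM : M.IsSymm)
    (z : n → ℂ) (l : n) :
    HasDerivAt (fun t => Function.update z l t ⬝ᵥ M *ᵥ Function.update z l t)
      (2 * (M *ᵥ z) l) (z l) := by
  have hu := hasDerivAt_pi.mp (hasDerivAt_update z l (z l))
  have hMu (i : n) : HasDerivAt (fun t => (M *ᵥ Function.update z l t) i)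
      (∑ j, M i j * (Pi.single l 1 : n → ℂ) j) (z l) :=
    HasDerivAt.fun_sum fun j _ => (hu j).const_mul (M i j)
  refine (HasDerivAt.fun_sum fun i _ => (hu i).fun_mul (hMu i)).congr_deriv ?_
  simp only [Function.update_eq_self, Finset.sum_add_distrib, Pi.single_apply, mul_ite, mul_one,
    mul_zero, ite_mul, one_mul, zero_mul, Finset.sum_ite_eq', Finset.mem_univ, if_true, two_mul]
  congr 1
  simp only [mulVec, dotProduct]
  exact Finset.sum_congr rfl fun i _ => by rw [hM.apply, mul_comm]

theorem hasDerivAt_dotProduct_update (z v : n → ℂ) (l : n) :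
    HasDerivAt (fun t => Function.update z l t ⬝ᵥ v) (v l) (z l) := by
  have hu := hasDerivAt_pi.mp (hasDerivAt_update z l (z l))
  refine (HasDerivAt.fun_sum fun i _ => (hu i).mul_const (v i)).congr_deriv ?_
  simp [Pi.single_apply]

end

theorem cinner_conj_left {d : ℕ} (a b : Fin d → ℂ) :
    cinner (fun j => (starRingEnd ℂ) (a j)) b = a ⬝ᵥ b := by
  simp [cinner, dotProduct]

theorem cinner_mulVec_stdC {d : ℕ} (M : Matrix (Fin d) (Fin d) ℂ) (l : Fin d)
    (v : Fin d → ℂ) : cinner (M *ᵥ stdC l) v = (Mᴴ *ᵥ v) l := by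
  rw [stdC, mulVec_single_one]
  simp [cinner, mulVec, dotProduct]

/-- First `z_l`-derivative of the generating function:
`∂G/∂z_l(x,z) = 2 ⟨U_A e_l, |A|⁻¹x/√ℏ − conj(U_A) z⟩ G(x,z)`, where `S = |A|` is the
positive definite square root of `A A*` and `U_A = |A|⁻¹ A`. -/
theorem generating_function_first_derivative
    {d : ℕ} (hd : 1 ≤ d) {hbar : ℝ} (hhbar : 0 < hbar)
    (A B : Matrix (Fin d) (Fin d) ℂ) (hA : IsUnit A.det) (hB : IsUnit B.det)
    (hAB₁ : Aᴴ * B + Bᴴ * A = (2 : ℂ) • (1 : Matrix (Fin d) (Fin d) ℂ))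
    (hAB₂ : Aᵀ * B - Bᵀ * A = 0)
    (sqrtA : ℂ) (hsqrtA : sqrtA ^ 2 = A.det)
    (S : Matrix (Fin d) (Fin d) ℂ) (hS : S.PosDef) (hSS : S * S = A * Aᴴ)
    (x : Fin d → ℝ) (z : Fin d → ℂ) (l : Fin d) :
    deriv (fun t => Gfun A hbar x (Function.update z l t)) (z l) =
      2 * cinner ((S⁻¹ * A).mulVec (stdC l))
          (fun j => S⁻¹.mulVec (cvec x) j / ((Real.sqrt hbar : ℝ) : ℂ)
            - ((S⁻¹ * A).map (starRingEnd ℂ)).mulVec z j) *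
        Gfun A hbar x z := by
  have hsymm := isSymm_mul_conjTranspose hA hAB₁ hAB₂
  simp only [Gfun, cinner_conj_left, map_starRingEnd_eq]
  have hderiv := ((hasDerivAt_dotProduct_mulVec_update
    (isSymm_inv_mul_conj hA hsymm) z l).neg.add
      ((hasDerivAt_dotProduct_update z (A⁻¹ *ᵥ cvec x) l).const_mul
        (2 / ((Real.sqrt hbar : ℝ) : ℂ)))).cexp
  refine hderiv.deriv.trans ?_
  have hvec : (fun j => (S⁻¹ *ᵥ cvec x) j / ((Real.sqrt hbar : ℝ) : ℂ)
      - ((S⁻¹ * A)ᴴᵀ *ᵥ z) j) =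
      ((Real.sqrt hbar : ℝ) : ℂ)⁻¹ • (S⁻¹ *ᵥ cvec x) - (S⁻¹ * A)ᴴᵀ *ᵥ z := by
    ext j
    simp [div_eq_inv_mul]
  rw [hvec, cinner_mulVec_stdC, mulVec_sub, mulVec_smul, mulVec_mulVec, mulVec_mulVec,
    conjTranspose_polar_mul_inv hA hS.isHermitian hSS,
    conjTranspose_polar_mul_conj_polar hA hS hSS hsymm]
  simp only [Pi.add_apply, Pi.neg_apply, Function.update_eq_self, Pi.sub_apply, Pi.smul_apply,
    smul_eq_mul]
  ring

end
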